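/- Fix an irrational α with 0 < α < 1, and let f be a measurable Roman dominating function for the irrational cycle graph G_α of measured value exactly 2/3, i.e. 2·μ(f⁻¹{2}) + μ(f⁻¹{1}) = 2/3. Then the set of social vertices of f, {v ∈ ℝ/ℤ : f(v) = 2 and (f(v + α) = 2 or f(v − α) = 2)}, is a μ-null set. -/

import Mathlib

open MeasureTheory
open scoped ENNReal

/-- If `A` and `B` together with two equal-measure sets cover the circle at the critical
value, then the overlap is null. -/
lemma overlap_null (A B C D : Set (AddCircle (1:ℝ))) (hC : MeasurableSet C)
    (eC : volume C = volume A) (eD : volume D = volume A)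
    (hcov : ∀ v, v ∈ A ∨ v ∈ B ∨ v ∈ C ∨ v ∈ D)
    (hval : 2 * volume A + volume B = 2/3) : volume (A ∩ C) = 0 := by
  have hu : volume (Set.univ : Set (AddCircle (1:ℝ))) = 1 := by
    rw [AddCircle.measure_univ]; simp
  have hA := measure_ne_top volume A
  have hB := measure_ne_top volume B
  have hx := measure_ne_top volume (A ∩ C)
  have k1 := measure_union_add_inter (μ := volume) A hC
  have k2 : (1 : ℝ≥0∞) ≤ volume (A ∪ C) + volume B + volume D := by
    rw [← hu]
    refine (measure_mono ?_).trans ((measure_union_le (A ∪ C ∪ B) D).trans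
      (add_le_add_left (measure_union_le (A ∪ C) B) _))
    intro v _
    have := hcov v
    simp only [Set.mem_union]
    tauto
  rw [eC] at k1
  rw [eD] at k2
  have hU := measure_ne_top volume (A ∪ C)
  generalize volume A = a at *
  generalize volume B = b at *
  generalize volume (A ∩ C) = x at *
  generalize volume (A ∪ C) = u at *
  lift a to NNReal using hA
  lift b to NNReal using hB
  lift x to NNReal using hx
  lift u to NNReal using hU
  have hv := congrArg ENNReal.toReal hval
  rw [ENNReal.toReal_add (by finiteness) (by finiteness)] at hv
  simp at hv
  norm_cast at k1 k2
  have k1' : (u : ℝ) + x = a + a := by exact_mod_cast k1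
  have k2' : (1 : ℝ) ≤ u + b + a := by exact_mod_cast k2
  have hb := b.2
  have hx := x.2
  have : (x : ℝ) = 0 := by
    simp only [NNReal.val_eq_coe] at hb hx
    linarith
  exact_mod_cast this

/-- If a measurable Roman dominating function for the irrational cycle graph
`G_α` has measured value exactly `2/3`, then its set of social vertices is a
null set. -/
theorem social_vertices_null
    (α : ℝ) (hirr : Irrational α) (h0 : 0 < α) (h1 : α < 1)
    (f : AddCircle (1:ℝ) → ℕ) (hf2 : ∀ v, f v ≤ 2)
    (hrdf : ∀ v, f v = 0 →
      f (v + (α : AddCircle (1:ℝ))) = 2 ∨ f (v - (α : AddCircle (1:ℝ))) = 2)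
    (h1m : MeasurableSet (f ⁻¹' {1})) (h2m : MeasurableSet (f ⁻¹' {2}))
    (hval : 2 * volume (f ⁻¹' {2}) + volume (f ⁻¹' {1}) = 2/3) :
    volume {v : AddCircle (1:ℝ) | f v = 2 ∧
      (f (v + (α : AddCircle (1:ℝ))) = 2 ∨ f (v - (α : AddCircle (1:ℝ))) = 2)} = 0 := by
  have mp := measurePreserving_add_right (volume : Measure (AddCircle (1:ℝ))) (α : AddCircle (1:ℝ))
  have mm := measurePreserving_sub_right (volume : Measure (AddCircle (1:ℝ))) (α : AddCircle (1:ℝ))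
  have ep := mp.measure_preimage h2m.nullMeasurableSet
  have em := mm.measure_preimage h2m.nullMeasurableSet
  have cov : ∀ v, f v = 2 ∨ f v = 1 ∨ f (v + (α : AddCircle (1:ℝ))) = 2 ∨
      f (v - (α : AddCircle (1:ℝ))) = 2 := by
    intro v
    have h := hf2 v
    have h' := hrdf v
    by_cases hz : f v = 0
    · exact Or.inr (Or.inr (h' hz))
    · have : f v = 2 ∨ f v = 1 := by omega
      tauto
  have n1 := overlap_null _ _ _ _ (mp.measurable h2m) ep em cov hval
  have n2 := overlap_null _ _ _ _ (mm.measurable h2m) em ep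
    (fun v => (cov v).imp id (Or.imp id Or.symm)) hval
  refine measure_mono_null ?_ (measure_union_null n1 n2)
  rintro v ⟨hv, h | h⟩
  · exact Or.inl ⟨hv, h⟩
  · exact Or.inr ⟨hv, h⟩
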